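/- Let X be a finite cycle set and suppose there is a surjective cycle set homomorphism p : X → Y onto a cycle set Y of prime cardinality, and there exist x, y ∈ X with x·y = y. Then X is decomposable (G(X) does not act transitively on X). -/

import Mathlib

/-- A finite abelian group whose order is divisible by a prime `p` has a nonzero character with
values in `ZMod p`. -/
theorem exists_addMonoidHom_zmod_ne_zero {A : Type*} [AddCommGroup A] [Finite A] {p : ℕ}
    [Fact p.Prime] (h : p ∣ Nat.card A) : ∃ f : A →+ ZMod p, f ≠ 0 := by
  obtain ⟨x, hx⟩ := exists_prime_addOrderOf_dvd_card' p h
  have hinj : ¬ Function.Injective (LinearMap.lsmul ℤ A p) := fun hi => by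
    have hx0 : x = 0 := hi (by simp [← hx, addOrderOf_nsmul_eq_zero])
    rw [hx0, addOrderOf_zero] at hx
    exact (Fact.out : p.Prime).one_lt.ne hx
  rw [Finite.injective_iff_surjective] at hinj
  simp only [Function.Surjective, not_forall] at hinj
  obtain ⟨a, ha⟩ := hinj
  have hne : ModN.mkQ p a ≠ 0 := fun h0 =>
    ha (LinearMap.mem_range.mp ((Submodule.Quotient.mk_eq_zero _).mp h0))
  by_contra! hzero
  refine hne ((Module.forall_dual_apply_eq_zero_iff (ZMod p) _).mp fun φ => ?_)
  exact DFunLike.congr_fun (hzero (φ.toAddMonoidHom.comp (ModN.mkQ p))) a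

/-- A permutation of order `p` fixes a nonzero vector in every nonzero invariant subspace of
functions with values in `ZMod p`. -/
theorem Submodule.exists_ne_zero_comp_perm_eq {Y : Type*} {p : ℕ} [Fact p.Prime]
    {ρ : Equiv.Perm Y} (hρ : ρ ^ p = 1) {V : Submodule (ZMod p) (Y → ZMod p)}
    (hV : ∀ f ∈ V, f ∘ ρ ∈ V) {f : Y → ZMod p} (hf : f ∈ V) (hf0 : f ≠ 0) :
    ∃ g ∈ V, g ≠ 0 ∧ g ∘ ρ = g := by
  classical
  let T : Module.End (ZMod p) (Y → ZMod p) := LinearMap.funLeft _ _ ρ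
  have hTpow (n : ℕ) (g : Y → ZMod p) : (T ^ n) g = g ∘ (ρ ^ n : Equiv.Perm Y) := by
    induction n generalizing g with
    | zero => rfl
    | succ n ih => rw [pow_succ, Module.End.mul_apply, ih, pow_succ']; rfl
  have : Nontrivial (Y → ZMod p) := ⟨f, 0, hf0⟩
  have : CharP (Module.End (ZMod p) (Y → ZMod p)) p :=
    charP_of_injective_algebraMap (algebraMap (ZMod p) _).injective p
  have hnil : ((T - 1) ^ p) f = 0 := by
    rw [sub_pow_char_of_commute p (Commute.one_right T), one_pow, LinearMap.sub_apply, hTpow, hρ]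
    exact sub_self f
  have hmem (n : ℕ) : ((T - 1) ^ n : Module.End (ZMod p) (Y → ZMod p)) f ∈ V := by
    induction n with
    | zero => exact hf
    | succ n ih =>
      rw [pow_succ', Module.End.mul_apply]
      exact V.sub_mem (hV _ ih) ih
  have hex : ∃ n : ℕ, ((T - 1) ^ n) f = 0 := ⟨p, hnil⟩
  have hpos : Nat.find hex ≠ 0 := fun h0 => hf0 (by simpa [h0] using Nat.find_spec hex)
  obtain ⟨k, hk⟩ := Nat.exists_eq_succ_of_ne_zero hpos
  refine ⟨((T - 1) ^ k) f, hmem k, Nat.find_min hex (by omega), sub_eq_zero.mp ?_⟩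
  have hspec := Nat.find_spec hex
  rw [hk, pow_succ', Module.End.mul_apply] at hspec
  exact hspec

theorem Equiv.Perm.isCycle_and_support_eq_univ {Y : Type*} [Fintype Y] [DecidableEq Y]
    (hY : (Fintype.card Y).Prime) {ρ : Equiv.Perm Y} (hρ : orderOf ρ = Fintype.card Y) :
    ρ.IsCycle ∧ ρ.support = Finset.univ := by
  have hc := Equiv.Perm.isCycle_of_prime_order'' hY hρ
  exact ⟨hc, Finset.card_eq_iff_eq_univ _ |>.mp (hc.orderOf ▸ hρ)⟩

namespace CycleSet

variable {Y : Type*} {σ : Y → Equiv.Perm Y}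

/-- The permutation attached to an element of the free commutative monoid on a cycle set; it
satisfies the cocycle identity `multisetPerm_add`. -/
def multisetPerm (hσ : ∀ x y z, σ (σ x y) (σ x z) = σ (σ y x) (σ y z)) (a : Multiset Y) :
    Equiv.Perm Y :=
  haveI : LeftCommutative fun (x : Y) (g : Equiv.Perm Y) => σ (g x) * g :=
    ⟨fun _ _ _ => Equiv.ext fun _ => hσ _ _ _⟩
  a.foldr (fun x g => σ (g x) * g) 1

variable (hσ : ∀ x y z, σ (σ x y) (σ x z) = σ (σ y x) (σ y z))

theorem multisetPerm_zero : multisetPerm hσ 0 = 1 := rfl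

theorem multisetPerm_cons (x : Y) (a : Multiset Y) :
    multisetPerm hσ (x ::ₘ a) = σ (multisetPerm hσ a x) * multisetPerm hσ a := by
  simp only [multisetPerm, Multiset.foldr_cons]

theorem multisetPerm_singleton (x : Y) : multisetPerm hσ {x} = σ x := by
  rw [← Multiset.cons_zero, multisetPerm_cons, multisetPerm_zero, mul_one, Equiv.Perm.one_apply]

theorem multisetPerm_add (a b : Multiset Y) :
    multisetPerm hσ (a + b) =
      multisetPerm hσ (b.map (multisetPerm hσ a)) * multisetPerm hσ a := by
  induction b using Multiset.induction_on with
  | empty => simp [multisetPerm_zero]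
  | cons x b ih =>
    rw [Multiset.add_cons, multisetPerm_cons, ih, Multiset.map_cons, multisetPerm_cons]
    simp [mul_assoc]

theorem multisetPerm_mul (a b : Multiset Y) :
    multisetPerm hσ a * multisetPerm hσ b =
      multisetPerm hσ (b + a.map (multisetPerm hσ b).symm) := by
  rw [multisetPerm_add, Multiset.map_map, Equiv.self_comp_symm, Multiset.map_id]

theorem exists_multisetPerm_eq_pow (a : Multiset Y) (n : ℕ) :
    ∃ b, b.card = n * a.card ∧ multisetPerm hσ b = multisetPerm hσ a ^ n := by
  induction n with
  | zero => exact ⟨0, by simp, rfl⟩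
  | succ n ih =>
    obtain ⟨b, hb, h⟩ := ih
    refine ⟨b + a.map (multisetPerm hσ b).symm, ?_, by rw [pow_succ', ← h, multisetPerm_mul]⟩
    rw [Multiset.card_add, Multiset.card_map, hb, Nat.succ_mul]

theorem multisetPerm_map_eq {a b c d : Multiset Y} (hab : multisetPerm hσ a = multisetPerm hσ b)
    (hcd : multisetPerm hσ c = multisetPerm hσ d) :
    multisetPerm hσ (a.map (multisetPerm hσ c)) = multisetPerm hσ (b.map (multisetPerm hσ d)) := by
  have key (a : Multiset Y) : multisetPerm hσ (a.map (multisetPerm hσ c)) =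
      multisetPerm hσ (c + a) * (multisetPerm hσ c)⁻¹ := by
    rw [multisetPerm_add, mul_inv_cancel_right]
  rw [← hcd, key, key, add_comm c a, add_comm c b, multisetPerm_add, multisetPerm_add, hab]

variable [Finite Y]

/-- The permutation group `G(Y)` of a finite cycle set, as the set of values of `multisetPerm`. -/
def permGroup : Subgroup (Equiv.Perm Y) where
  carrier := Set.range (multisetPerm hσ)
  one_mem' := ⟨0, rfl⟩
  mul_mem' := by
    rintro _ _ ⟨a, rfl⟩ ⟨b, rfl⟩
    exact ⟨_, (multisetPerm_mul hσ a b).symm⟩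
  inv_mem' := by
    rintro _ ⟨a, rfl⟩
    obtain ⟨b, -, hb⟩ := exists_multisetPerm_eq_pow hσ a (orderOf (multisetPerm hσ a) - 1)
    refine ⟨b, hb.trans (eq_inv_of_mul_eq_one_left ?_)⟩
    rw [← pow_succ, Nat.sub_add_cancel (orderOf_pos _), pow_orderOf_eq_one]

theorem exists_multisetPerm_eq_inv (a : Multiset Y) :
    ∃ b, multisetPerm hσ b = (multisetPerm hσ a)⁻¹ :=
  (permGroup hσ).inv_mem ⟨a, rfl⟩

/-- Multisets with the same permutation are identified; the quotient is the additive group of the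
brace structure on `G(Y)`. -/
def permCon : AddCon (Multiset Y) where
  toSetoid := Setoid.ker (multisetPerm hσ)
  add' := by
    intro a b c d hab hcd
    change multisetPerm hσ (a + c) = multisetPerm hσ (b + d)
    rw [multisetPerm_add, multisetPerm_add, multisetPerm_map_eq hσ hcd hab,
      show multisetPerm hσ a = multisetPerm hσ b from hab]

theorem permCon_exists_neg (q : (permCon hσ).Quotient) : ∃ r, r + q = 0 := by
  induction q using AddCon.induction_on with
  | H a =>
    obtain ⟨d, hd⟩ := exists_multisetPerm_eq_inv hσ a
    refine ⟨((d.map (multisetPerm hσ a).symm : Multiset Y) : (permCon hσ).Quotient), ?_⟩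
    refine (AddCon.eq _).mpr (show multisetPerm hσ _ = multisetPerm hσ 0 from ?_)
    change multisetPerm hσ (_ + a) = _
    rw [add_comm, ← multisetPerm_mul, hd, inv_mul_cancel, multisetPerm_zero]

noncomputable instance : Neg (permCon hσ).Quotient where
  neg q := (permCon_exists_neg hσ q).choose

noncomputable instance : AddCommGroup (permCon hσ).Quotient where
  zsmul := zsmulRec
  neg_add_cancel q := (permCon_exists_neg hσ q).choose_spec
  add_comm := add_comm

/-- The additive and the multiplicative group of the brace `G(Y)` have the same elements. -/
noncomputable def permConQuotientEquiv : (permCon hσ).Quotient ≃ permGroup hσ :=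
  Setoid.quotientKerEquivRange (multisetPerm hσ)

instance : Finite (permCon hσ).Quotient := .of_equiv _ (permConQuotientEquiv hσ).symm

/-- In an indecomposable cycle set of prime cardinality `p`, multisets acting trivially have
cardinality divisible by `p`. -/
theorem prime_dvd_card_of_multisetPerm_eq_one [Fintype Y] (hY : (Fintype.card Y).Prime)
    (htrans : ∀ x y, ∃ g ∈ permGroup hσ, g x = y) {a : Multiset Y}
    (ha : multisetPerm hσ a = 1) : Fintype.card Y ∣ a.card := by
  classical
  set p := Fintype.card Y with hp
  have : Fact p.Prime := ⟨hY⟩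
  have hdvd : p ∣ Nat.card (permGroup hσ) := by
    obtain ⟨y⟩ : Nonempty Y := Fintype.card_pos_iff.mp hY.pos
    have : MulAction.IsPretransitive (permGroup hσ) Y :=
      ⟨fun x y => let ⟨g, hg, h⟩ := htrans x y; ⟨⟨g, hg⟩, h⟩⟩
    rw [hp, ← Nat.card_eq_fintype_card, ← MulAction.index_stabilizer_of_transitive (permGroup hσ) y]
    exact Subgroup.index_dvd_card _
  obtain ⟨f, hf⟩ := exists_addMonoidHom_zmod_ne_zero
    (Nat.card_congr (permConQuotientEquiv hσ) ▸ hdvd)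
  obtain ⟨⟨ρ, hmem⟩, hρ⟩ := exists_prime_orderOf_dvd_card' p hdvd
  rw [Subgroup.orderOf_mk] at hρ
  obtain ⟨c, rfl⟩ := hmem
  let V : Submodule (ZMod p) (Y → ZMod p) :=
    { carrier := {h | ∀ a, multisetPerm hσ a = 1 → (a.map h).sum = 0}
      zero_mem' := by simp
      add_mem' := fun {g h} hg hh a ha => by
        simp [hg a ha, hh a ha]
      smul_mem' := fun r h hh a ha => by
        simpa [hh a ha] using Multiset.sum_map_mul_left (s := a) (a := r) (f := h) }
  let h : Y → ZMod p := fun y => f (({y} : Multiset Y) : (permCon hσ).Quotient)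
  have hsum (a : Multiset Y) : (a.map h).sum = f (a : (permCon hσ).Quotient) := by
    induction a using Multiset.induction_on with
    | empty => exact (map_zero f).symm
    | cons x a ih =>
      rw [Multiset.map_cons, Multiset.sum_cons, ih, ← map_add, ← AddCon.coe_add,
        Multiset.singleton_add]
  have hh : h ∈ V := fun a ha => by
    rw [hsum, (AddCon.eq (permCon hσ)).mpr (show multisetPerm hσ a = multisetPerm hσ 0 from ha)]
    exact map_zero f
  have hh0 : h ≠ 0 := fun h0 => hf <| by
    refine AddMonoidHom.ext fun q => ?_
    induction q using AddCon.induction_on with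
    | H a => rw [← hsum, h0]; simp
  have hV : ∀ g ∈ V, g ∘ multisetPerm hσ c ∈ V := fun g hg a ha => by
    rw [← Multiset.map_map]
    refine hg _ ?_
    rw [multisetPerm_map_eq hσ (b := 0) (d := c) ha rfl, Multiset.map_zero, multisetPerm_zero]
  obtain ⟨g, hgV, hg0, hg⟩ :=
    Submodule.exists_ne_zero_comp_perm_eq (hρ ▸ pow_orderOf_eq_one _) hV hh hh0
  obtain ⟨hcyc, hsupp⟩ := Equiv.Perm.isCycle_and_support_eq_univ hY hρ
  have hzpow (n : ℤ) (y : Y) : g ((multisetPerm hσ c ^ n) y) = g y := by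
    induction n generalizing y with
    | zero => rfl
    | succ n ih => rw [zpow_add_one, Equiv.Perm.mul_apply, ih]; exact congrFun hg y
    | pred n ih =>
      rw [zpow_sub_one, Equiv.Perm.mul_apply, ih, ← congrFun hg]
      simp
  have hmoved (y : Y) : multisetPerm hσ c y ≠ y :=
    Equiv.Perm.mem_support.mp (hsupp ▸ Finset.mem_univ y)
  obtain ⟨y, hy⟩ := Function.ne_iff.mp hg0
  have hconst : g = fun _ => g y := funext fun z => by
    obtain ⟨n, rfl⟩ := hcyc.sameCycle (hmoved y) (hmoved z)
    exact hzpow n y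
  have hfinal := hgV a ha
  rw [hconst, Multiset.map_const', Multiset.sum_replicate, nsmul_eq_mul] at hfinal
  exact (ZMod.natCast_eq_zero_iff _ _).mp ((mul_eq_zero.mp hfinal).resolve_right hy)

/-- Left multiplications of an indecomposable cycle set of prime cardinality have no fixed
points. -/
theorem apply_ne_self_of_prime_card [Fintype Y] (hY : (Fintype.card Y).Prime)
    (htrans : ∀ x y, ∃ g ∈ permGroup hσ, g x = y) (x y : Y) : σ x y ≠ y := by
  classical
  intro hxy
  obtain ⟨b, hb, hpow⟩ := exists_multisetPerm_eq_pow hσ {x} (orderOf (σ x))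
  rw [multisetPerm_singleton, pow_orderOf_eq_one] at hpow
  have hdvd := prime_dvd_card_of_multisetPerm_eq_one hσ hY htrans hpow
  rw [hb, Multiset.card_singleton, mul_one] at hdvd
  have hord := orderOf_pow_orderOf_div (orderOf_pos (σ x)).ne' hdvd
  have hsupp := (Equiv.Perm.isCycle_and_support_eq_univ hY hord).2
  exact Equiv.Perm.mem_support.mp (hsupp ▸ Finset.mem_univ y)
    (Equiv.Perm.pow_apply_eq_self_of_apply_eq_self hxy _)

end CycleSet


/-- If a finite cycle set X admits a surjective homomorphism onto a cycle set
of prime cardinality and some σ_x has a fixed point, then X is decomposable. -/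
theorem cs_fixed_point_decomposable {X Y : Type*} [Fintype X] [Fintype Y]
    (σ : X → Equiv.Perm X) (σ' : Y → Equiv.Perm Y)
    (hcs : ∀ x y z : X, σ (σ x y) (σ x z) = σ (σ y x) (σ y z))
    (hcs' : ∀ x y z : Y, σ' (σ' x y) (σ' x z) = σ' (σ' y x) (σ' y z))
    (p : X → Y) (hsurj : Function.Surjective p)
    (hhom : ∀ x y : X, p (σ x y) = σ' (p x) (p y))
    (hYprime : (Fintype.card Y).Prime)
    (hfix : ∃ x y : X, σ x y = y) :
    ¬ ∀ x y : X,
      ∃ g ∈ Subgroup.closure {g : Equiv.Perm X | ∃ z, g = σ z}, g x = y := by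
  intro htrans
  obtain ⟨x, y, hxy⟩ := hfix
  refine CycleSet.apply_ne_self_of_prime_card hcs' hYprime ?_ (p x) (p y) (by rw [← hhom, hxy])
  intro u v
  obtain ⟨u, rfl⟩ := hsurj u
  obtain ⟨v, rfl⟩ := hsurj v
  obtain ⟨g, hg, rfl⟩ := htrans u v
  have hlift : ∃ g' ∈ CycleSet.permGroup hcs', ∀ z, g' (p z) = p (g z) := by
    induction hg using Subgroup.closure_induction with
    | mem g hg =>
      obtain ⟨w, rfl⟩ := hg
      exact ⟨σ' (p w), ⟨{p w}, CycleSet.multisetPerm_singleton hcs' _⟩, fun z => (hhom w z).symm⟩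
    | one => exact ⟨1, one_mem _, fun _ => rfl⟩
    | mul g h _ _ ihg ihh =>
      obtain ⟨g', hg', eg⟩ := ihg
      obtain ⟨h', hh', eh⟩ := ihh
      exact ⟨g' * h', mul_mem hg' hh', fun z => by
        rw [Equiv.Perm.mul_apply, eh, eg, Equiv.Perm.mul_apply]⟩
    | inv g _ ih =>
      obtain ⟨g', hg', eg⟩ := ih
      exact ⟨g'⁻¹, inv_mem hg', fun z => by
        rw [Equiv.Perm.inv_eq_iff_eq, eg, ← Equiv.Perm.mul_apply, mul_inv_cancel, Equiv.Perm.one_apply]⟩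
  obtain ⟨g', hg', h⟩ := hlift
  exact ⟨g', hg', h u⟩
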